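/- arXiv:2303.04312 — 2 statements merged into one kernel-verified Lean document; each statement's English description precedes it below -/
import Mathlib

section
/- Let p be a prime with p ≡ 1 (mod 4), and suppose e₁, f₁ ∈ ℤ satisfy p = e₁² + 4f₁² with e₁ ≡ 1 (mod 4) and p not dividing e₁. For ℓ ≥ 1 let f_ℓ = Im((e₁ + 2f₁·i)^ℓ) = −(i/4)(e₁ + 2f₁·i)^ℓ + (i/4)(e₁ − 2f₁·i)^ℓ. Then for every ℓ ≥ 1, the number of cliques of size 4 in the Paley graph Γ(2, p^ℓ) is K_4(Γ(2, p^ℓ)) = p^ℓ (p^ℓ − 1)((p^ℓ − 9)² − 16 f_ℓ²) / (2⁹ · 3). -/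
open Complex

/-- The number of cliques of size `n` in a graph `G`. -/
noncomputable def SimpleGraph.cliqueCount {V : Type*} (G : SimpleGraph V) (n : ℕ) : ℕ :=
  Nat.card {s : Finset V // G.IsNClique n s}

/-- The generalized Paley graph `Γ(k,q)` on a finite field `F` with `q` elements: distinct
`x, y` are adjacent iff `y - x` is a `k`-th power of a nonzero element of `F`. -/
def paleyGraph (F : Type*) [Field F] (k : ℕ) : SimpleGraph F :=
  SimpleGraph.fromRel fun x y => ∃ z : F, z ≠ 0 ∧ y - x = z ^ k

section helpers
open Finset

set_option linter.unusedSectionVars false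

section paley
variable {F : Type*} [Field F] [Fintype F] [DecidableEq F]

local notation "φ" => quadraticChar F

lemma sum_affine (f : F → ℤ) (c d : F) (hc : c ≠ 0) : ∑ x, f (c * x + d) = ∑ x, f x :=
  Equiv.sum_comp ((Equiv.mulLeft₀ c hc).trans (Equiv.addRight d)) f

lemma sum_sub_const (f : F → ℤ) (d : F) : ∑ x, f (x - d) = ∑ x, f x :=
  Equiv.sum_comp (Equiv.subRight d) f

lemma ringChar_ne_two (hq : Fintype.card F % 4 = 1) : ringChar F ≠ 2 := by
  intro h
  have := FiniteField.even_card_of_char_two h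
  omega

lemma phi_neg_one (hq : Fintype.card F % 4 = 1) : φ (-1) = 1 := by
  rw [quadraticChar_one_iff_isSquare (by simp), FiniteField.isSquare_neg_one_iff]
  omega

lemma phi_neg (hq : Fintype.card F % 4 = 1) (a : F) : φ (-a) = φ a := by
  rw [← neg_one_mul, map_mul, phi_neg_one hq, one_mul]

lemma phi_sub_comm (hq : Fintype.card F % 4 = 1) (a b : F) : φ (a - b) = φ (b - a) := by
  rw [← phi_neg hq, neg_sub]

lemma phi_sum (hq : Fintype.card F % 4 = 1) : ∑ x : F, φ x = 0 :=
  quadraticChar_sum_zero (ringChar_ne_two hq)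

lemma phi_sum_sub (hq : Fintype.card F % 4 = 1) (d : F) : ∑ x : F, φ (x - d) = 0 := by
  rw [sum_sub_const (fun x => φ x), phi_sum hq]

lemma phi_sq (a : F) (ha : a ≠ 0) : φ a * φ a = 1 := by
  rw [← sq, quadraticChar_sq_one ha]

lemma phi_sq_sum : ∑ x : F, φ x * φ x = (Fintype.card F : ℤ) - 1 := by
  have : ∀ x : F, φ x * φ x = 1 - if x = 0 then 1 else 0 := by
    intro x
    by_cases h : x = 0
    · simp [h]
    · rw [phi_sq x h, if_neg h, sub_zero]
  simp_rw [this, Finset.sum_sub_distrib]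
  simp

lemma phi_sum_quad (hq : Fintype.card F % 4 = 1) (a b : F) :
    ∑ t : F, φ (t - a) * φ (t - b) = if a = b then (Fintype.card F : ℤ) - 1 else -1 := by
  split_ifs with h
  · subst h
    rw [sum_sub_const (fun x => φ x * φ x), phi_sq_sum]
  · have hab : b - a ≠ 0 := fun h' => h (sub_eq_zero.mp h').symm
    rw [← sum_affine (fun t => φ (t - a) * φ (t - b)) (b - a) a hab]
    have hj := jacobiSum_nontrivial_inv (χ := φ) (quadraticChar_ne_one (ringChar_ne_two hq))
    rw [(quadraticChar_isQuadratic F).inv, phi_neg_one hq, jacobiSum] at hj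
    rw [← hj]
    refine Finset.sum_congr rfl fun x _ => ?_
    have e1 : (b - a) * x + a - a = (b - a) * x := by ring
    have e2 : (b - a) * x + a - b = -((b - a) * (1 - x)) := by ring
    simp only [e1, e2, phi_neg hq, map_mul]
    have := phi_sq _ hab
    linear_combination (φ x * φ (1 - x)) * this

lemma sum_comp_sq (hq : Fintype.card F % 4 = 1) (h : F → ℤ) :
    ∑ k : F, h (k ^ 2) = ∑ x, (1 + φ x) * h x := by
  rw [← Finset.sum_fiberwise (s := univ) (g := fun k : F => k ^ 2)]
  refine Finset.sum_congr rfl fun x _ => ?_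
  rw [Finset.sum_congr rfl (g := fun _ => h x) (by intro k hk; simp at hk; rw [hk])]
  rw [Finset.sum_const, nsmul_eq_mul, add_comm, ← quadraticChar_card_sqrts (ringChar_ne_two hq)]
  congr 3
  ext; simp

lemma two_ne_zero_F (hq : Fintype.card F % 4 = 1) : (2 : F) ≠ 0 :=
  Ring.two_ne_zero (ringChar_ne_two hq)

lemma sum_comp_joukowski (hq : Fintype.card F % 4 = 1) (c : F) (hc : c ≠ 0) (h : F → ℤ) :
    ∑ m ∈ univ.filter (fun m : F => m ≠ 0), h (m + c / m) =
      ∑ v, (1 + φ (v ^ 2 - 4 * c)) * h v := by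
  have h2 := two_ne_zero_F hq
  rw [← Finset.sum_fiberwise (s := univ.filter (fun m : F => m ≠ 0))
    (g := fun m : F => m + c / m)]
  refine Finset.sum_congr rfl fun v _ => ?_
  rw [Finset.sum_congr rfl (g := fun _ => h v) (by intro k hk; simp at hk; rw [hk.2])]
  rw [Finset.sum_const, nsmul_eq_mul, add_comm, ← quadraticChar_card_sqrts (ringChar_ne_two hq)]
  congr 2
  refine Finset.card_bij (fun m _ => m - c / m) ?_ ?_ ?_
  · intro m hm
    simp at hm ⊢
    obtain ⟨h0, rfl⟩ := hm
    field_simp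
    ring
  · intro m hm n hn hmn
    simp at hm hn
    have : 2 * m = 2 * n := by linear_combination hmn + hm.2 - hn.2
    exact mul_left_cancel₀ h2 this
  · intro w hw
    simp at hw
    have hne : (v + w) / 2 ≠ 0 := by
      intro h0
      have : v + w = 0 := by
        rcases div_eq_zero_iff.mp h0 with h | h
        · exact h
        · exact absurd h h2
      have : 4 * c = 0 := by linear_combination hw + (v - w) * this
      have h4 : (4 : F) ≠ 0 := by
        have := mul_ne_zero h2 h2
        norm_num at this; exact this
      exact (mul_ne_zero h4 hc) this
    have hcd : c / ((v + w) / 2) = (v - w) / 2 := by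
      rw [div_eq_iff hne]
      field_simp
      linear_combination hw
    refine ⟨(v + w) / 2, ?_, ?_⟩
    · simp only [mem_filter, mem_univ, true_and]
      refine ⟨hne, ?_⟩
      rw [hcd]; field_simp; ring
    · rw [hcd]; field_simp; ring

/-- Legendre-type sum. -/
def Lsum (x : F) : ℤ := ∑ y : F, φ y * φ (y - 1) * φ (y - x)

/-- The double sum. -/
def Ssum (F : Type*) [Field F] [Fintype F] [DecidableEq F] : ℤ :=
  ∑ x : F, quadraticChar F x * quadraticChar F (x - 1) * Lsum x

/-- Jacobsthal sum. -/
def Jac (n : F) : ℤ := ∑ x : F, φ x * φ (x ^ 2 + n)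

lemma phi_quad0 (hq : Fintype.card F % 4 = 1) (b : F) (hb : b ≠ 0) :
    ∑ t : F, φ t * φ (t - b) = -1 := by
  have := phi_sum_quad hq 0 b
  rwa [if_neg hb.symm, Finset.sum_congr rfl (fun t _ => by rw [sub_zero])] at this

lemma L_sum (hq : Fintype.card F % 4 = 1) : ∑ x : F, Lsum x = 0 := by
  unfold Lsum
  rw [Finset.sum_comm]
  simp_rw [← Finset.mul_sum]
  refine Finset.sum_eq_zero fun y _ => ?_
  rw [Finset.sum_congr rfl (fun x _ => phi_sub_comm hq y x), phi_sum_sub hq, mul_zero]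

lemma L_zero (hq : Fintype.card F % 4 = 1) : Lsum (0 : F) = -1 := by
  have : ∀ y : F, φ y * φ (y - 1) * φ (y - 0) = φ (y - 1) - if y = 0 then 1 else 0 := by
    intro y
    by_cases h : y = 0
    · subst h; simp [phi_neg_one hq]
    · rw [if_neg h, sub_zero]; linear_combination φ (y - 1) * phi_sq y h
  unfold Lsum
  simp_rw [this, Finset.sum_sub_distrib, phi_sum_sub hq]
  simp

lemma L_one (hq : Fintype.card F % 4 = 1) : Lsum (1 : F) = -1 := by
  have : ∀ y : F, φ y * φ (y - 1) * φ (y - 1) = φ y - if y = 1 then 1 else 0 := by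
    intro y
    by_cases h : y = 1
    · subst h; simp
    · rw [if_neg h]; linear_combination φ y * phi_sq (y - 1) (sub_ne_zero.mpr h)
  unfold Lsum
  simp_rw [this, Finset.sum_sub_distrib, phi_sum hq]
  simp

lemma phi_L_sum0 (hq : Fintype.card F % 4 = 1) : ∑ x : F, φ x * Lsum x = 1 := by
  unfold Lsum
  simp_rw [Finset.mul_sum]
  rw [Finset.sum_comm]
  have : ∀ y : F, ∑ x, φ x * (φ y * φ (y - 1) * φ (y - x)) = - (φ y * φ (y - 1)) := by
    intro y
    by_cases h : y = 0
    · subst h; simp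
    · have := phi_quad0 hq y h
      rw [← mul_neg_one, ← this, Finset.mul_sum]
      refine Finset.sum_congr rfl fun x _ => ?_
      rw [phi_sub_comm hq y x]; ring
  simp_rw [this, Finset.sum_neg_distrib, phi_quad0 hq (1 : F) one_ne_zero]
  simp

lemma phi_L_sum1 (hq : Fintype.card F % 4 = 1) : ∑ x : F, φ (x - 1) * Lsum x = 1 := by
  unfold Lsum
  simp_rw [Finset.mul_sum]
  rw [Finset.sum_comm]
  have : ∀ y : F, ∑ x, φ (x - 1) * (φ y * φ (y - 1) * φ (y - x)) = - (φ y * φ (y - 1)) := by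
    intro y
    by_cases h : 1 = y
    · subst h; simp
    · have := phi_sum_quad hq 1 y
      rw [if_neg h] at this
      rw [← mul_neg_one, ← this, Finset.mul_sum]
      refine Finset.sum_congr rfl fun x _ => ?_
      rw [phi_sub_comm hq y x]; ring
  simp_rw [this, Finset.sum_neg_distrib, phi_quad0 hq (1 : F) one_ne_zero]
  simp

/-- Auxiliary double sum. -/
def Wsum (F : Type*) [Field F] [Fintype F] [DecidableEq F] : ℤ :=
  ∑ r : F, ∑ m : F, quadraticChar F m * quadraticChar F r * quadraticChar F (r ^ 2 + m) *
    quadraticChar F (1 + m)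

lemma phi_mul_sq (a b : F) (ha : a ≠ 0) : φ (a ^ 2 * b) = φ b := by
  rw [map_mul, quadraticChar_sq_one' ha, one_mul]

lemma g_sum (hq : Fintype.card F % 4 = 1) (r : F) :
    ∑ m : F, φ (r ^ 2 + m) * φ (1 + m) =
      -1 + (Fintype.card F : ℤ) * ((if r = 1 then 1 else 0) + (if r = -1 then 1 else 0)) := by
  have h2 := two_ne_zero_F hq
  have h := phi_sum_quad hq (-r ^ 2) (-1)
  have e : ∑ m : F, φ (r ^ 2 + m) * φ (1 + m) = ∑ t : F, φ (t - -r ^ 2) * φ (t - -1) := by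
    refine Finset.sum_congr rfl fun t _ => ?_
    congr 2 <;> ring
  rw [e, h]
  have hne : (1 : F) ≠ -1 := by
    intro h
    apply h2
    linear_combination h
  by_cases h1 : r = 1
  · subst h1
    simp [hne]; ring
  · by_cases h3 : r = -1
    · subst h3
      simp [hne.symm]; ring
    · have : ¬ (-r ^ 2 = -1) := by
        intro h
        rcases sq_eq_sq_iff_eq_or_eq_neg.mp ((neg_injective h).trans (one_pow 2).symm) with h | h
        · exact h1 h
        · exact h3 h
      rw [if_neg this, if_neg h1, if_neg h3]; ring

lemma W_eq (hq : Fintype.card F % 4 = 1) : Wsum F = (Jac (1 : F)) ^ 2 - 2 * Fintype.card F := by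
  have h1 : ∀ r : F, ∑ m : F, φ m * φ r * φ (r ^ 2 + m) * φ (1 + m) =
      φ r * ∑ x : F, φ (r ^ 2 + x ^ 2) * φ (1 + x ^ 2) -
      φ r * ∑ m : F, φ (r ^ 2 + m) * φ (1 + m) := by
    intro r
    rw [sum_comp_sq hq (fun m => φ (r ^ 2 + m) * φ (1 + m)), ← mul_sub, ← Finset.sum_sub_distrib,
      Finset.mul_sum]
    refine Finset.sum_congr rfl fun t _ => ?_
    ring
  have h2 : ∑ r : F, φ r * ∑ m : F, φ (r ^ 2 + m) * φ (1 + m) = 2 * Fintype.card F := by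
    simp_rw [g_sum hq]
    have : ∀ r : F, φ r * (-1 + (Fintype.card F : ℤ) *
        ((if r = 1 then 1 else 0) + (if r = -1 then 1 else 0))) =
        -φ r + Fintype.card F * ((if r = 1 then φ r else 0) + (if r = -1 then φ r else 0)) := by
      intro r
      split_ifs <;> ring
    simp_rw [this, Finset.sum_add_distrib, Finset.sum_neg_distrib, phi_sum hq, ← Finset.mul_sum,
      Finset.sum_add_distrib, Finset.sum_ite_eq' univ, if_pos (Finset.mem_univ _),
      phi_neg_one hq, map_one]
    ring
  have h3 : ∑ r : F, φ r * ∑ x : F, φ (r ^ 2 + x ^ 2) * φ (1 + x ^ 2) = (Jac (1 : F)) ^ 2 := by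
    simp_rw [Finset.mul_sum]
    rw [Finset.sum_comm]
    have : ∀ x : F, ∑ r : F, φ r * (φ (r ^ 2 + x ^ 2) * φ (1 + x ^ 2)) =
        φ x * φ (x ^ 2 + 1) * Jac (1 : F) := by
      intro x
      by_cases hx : x = 0
      · subst hx
        rw [quadraticChar_zero, zero_mul, zero_mul]
        have : ∀ r : F, φ r * (φ (r ^ 2 + 0 ^ 2) * φ (1 + 0 ^ 2)) = φ r := by
          intro r
          by_cases hr : r = 0
          · subst hr; simp
          · have e1 : r ^ 2 + 0 ^ 2 = r ^ 2 := by ring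
            have e2 : (1 : F) + 0 ^ 2 = 1 := by ring
            rw [e1, e2, quadraticChar_sq_one' hr, map_one]; ring
        simp_rw [this, phi_sum hq]
      · rw [← sum_affine (fun r => φ r * (φ (r ^ 2 + x ^ 2) * φ (1 + x ^ 2))) x 0 hx, Jac,
          Finset.mul_sum]
        refine Finset.sum_congr rfl fun r _ => ?_
        have e1 : (x * r + 0) ^ 2 + x ^ 2 = x ^ 2 * (r ^ 2 + 1) := by ring
        rw [e1, phi_mul_sq _ _ hx, add_zero, map_mul, add_comm (1 : F)]
        ring
    simp_rw [this, ← Finset.sum_mul]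
    rw [sq]
    rfl
  unfold Wsum
  simp_rw [h1, Finset.sum_sub_distrib, h2, h3]

lemma landen (hq : Fintype.card F % 4 = 1) (r : F) (hr : r ≠ 0) :
    ∑ m : F, φ m * φ (r ^ 2 + m) * φ (1 + m) =
    ∑ v : F, φ v * φ (v - (1 + r) ^ 2) * φ (v - (1 - r) ^ 2) := by
  have h1 : ∑ m : F, φ m * φ (r ^ 2 + m) * φ (1 + m) =
      ∑ m ∈ univ.filter (fun m : F => m ≠ 0), φ ((m + r ^ 2 / m) + (1 + r ^ 2)) := by
    rw [Finset.sum_filter]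
    refine Finset.sum_congr rfl fun m _ => ?_
    by_cases hm : m = 0
    · subst hm; simp
    · rw [if_pos hm, ← phi_mul_sq m ((m + r ^ 2 / m) + (1 + r ^ 2)) hm, ← map_mul, ← map_mul]
      congr 1
      field_simp
      ring
  rw [h1, sum_comp_joukowski hq (r ^ 2) (pow_ne_zero 2 hr) (fun v => φ (v + (1 + r ^ 2)))]
  simp_rw [add_mul, one_mul, Finset.sum_add_distrib]
  have h0 : ∑ x : F, φ (x + (1 + r ^ 2)) = 0 := by
    have := phi_sum_sub hq (-(1 + r ^ 2))
    simpa only [sub_neg_eq_add] using this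
  rw [h0, zero_add, ← sum_sub_const (fun x => φ (x ^ 2 - 4 * r ^ 2) * φ (x + (1 + r ^ 2)))
    (1 + r ^ 2)]
  refine Finset.sum_congr rfl fun v _ => ?_
  simp only [← map_mul]
  congr 1
  ring

lemma W_eq_S (hq : Fintype.card F % 4 = 1) : Wsum F = Ssum F := by
  have h2 := two_ne_zero_F hq
  have h4 : φ (4 : F) = 1 := by
    have := quadraticChar_sq_one' h2
    norm_num at this ⊢; exact this
  have hW : Wsum F = ∑ r : F, ∑ v : F, φ r * (φ v * φ (v - (1 + r) ^ 2) * φ (v - (1 - r) ^ 2)) := by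
    unfold Wsum
    refine Finset.sum_congr rfl fun r _ => ?_
    rw [← Finset.mul_sum]
    by_cases hr : r = 0
    · subst hr; simp
    · rw [← landen hq r hr, Finset.mul_sum]
      refine Finset.sum_congr rfl fun v _ => ?_
      ring
  set G : F → ℤ := fun r => ∑ v : F, φ r * (φ v * φ (v - (1 + r) ^ 2) * φ (v - (1 - r) ^ 2)) with hG
  have hm1 : G (-1) = -1 := by
    have : ∀ v : F, φ (-1) * (φ v * φ (v - (1 + -1) ^ 2) * φ (v - (1 - -1) ^ 2)) =
        φ (v - 4) - if v = 0 then 1 else 0 := by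
      intro v
      have e1 : v - (1 + -1) ^ 2 = v := by ring
      have e2 : v - (1 - -1) ^ 2 = v - 4 := by ring
      rw [e1, e2, phi_neg_one hq]
      by_cases hv : v = 0
      · subst hv
        rw [if_pos rfl, zero_sub, phi_neg hq, h4]; simp
      · rw [phi_sq v hv, if_neg hv]; ring
    rw [hG]
    simp only [this]
    rw [Finset.sum_sub_distrib, phi_sum_sub hq]
    simp
  have hk : ∀ k : F, k ≠ -1 → G ((1 - k) / (1 + k)) = φ (k ^ 2 - 1) * Lsum (k ^ 2) := by
    intro k hk
    have hk1 : 1 + k ≠ 0 := by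
      intro h; apply hk; linear_combination h
    have hA : (2 / (1 + k)) ≠ 0 := div_ne_zero h2 hk1
    have hA2 : (2 / (1 + k)) ^ 2 ≠ 0 := pow_ne_zero 2 hA
    simp only [hG]
    rw [← sum_affine _ _ 0 hA2, Lsum, Finset.mul_sum]
    refine Finset.sum_congr rfl fun v _ => ?_
    have e1 : (1 + (1 - k) / (1 + k)) = 2 / (1 + k) := by field_simp; ring
    have e2 : (1 - (1 - k) / (1 + k)) = 2 / (1 + k) * k := by field_simp; ring
    have e3 : (1 - k) / (1 + k) = (1 / (1 + k)) ^ 2 * (1 - k ^ 2) := by field_simp; ring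
    rw [e1, e2, e3, phi_mul_sq _ _ (one_div_ne_zero hk1), phi_sub_comm hq 1]
    have e4 : (2 / (1 + k)) ^ 2 * v + 0 - (2 / (1 + k)) ^ 2 = (2 / (1 + k)) ^ 2 * (v - 1) := by ring
    have e5 : (2 / (1 + k)) ^ 2 * v + 0 - (2 / (1 + k) * k) ^ 2
      = (2 / (1 + k)) ^ 2 * (v - k ^ 2) := by ring
    rw [e4, e5, add_zero, phi_mul_sq _ _ hA, phi_mul_sq _ _ hA, phi_mul_sq _ _ hA]
  have hsum : ∑ r : F, G r = G (-1) + ∑ k : F, φ (k ^ 2 - 1) * Lsum (k ^ 2) := by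
    rw [← Finset.add_sum_erase univ _ (Finset.mem_univ (-1 : F)),
      ← Finset.add_sum_erase univ (fun k : F => φ (k ^ 2 - 1) * Lsum (k ^ 2))
        (Finset.mem_univ (-1 : F))]
    have z : φ ((-1 : F) ^ 2 - 1) = 0 := by
      rw [quadraticChar_eq_zero_iff]; ring
    rw [z, zero_mul, zero_add]
    congr 1
    symm
    have hone : ∀ k : F, k ≠ -1 → 1 + k ≠ 0 := by
      intro k hk h; apply hk; linear_combination h
    have hinv : ∀ k : F, k ≠ -1 → (1 - (1 - k) / (1 + k)) / (1 + (1 - k) / (1 + k)) = k := by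
      intro k hk
      have := hone k hk
      have e1 : (1 + (1 - k) / (1 + k)) = 2 / (1 + k) := by field_simp; ring
      rw [e1]
      field_simp
      ring
    have hmem : ∀ k : F, k ≠ -1 → (1 - k) / (1 + k) ≠ -1 := by
      intro k hk h
      rw [div_eq_iff (hone k hk)] at h
      apply h2; linear_combination h
    refine Finset.sum_bij' (fun k _ => (1 - k) / (1 + k)) (fun k _ => (1 - k) / (1 + k))
      ?_ ?_ ?_ ?_ ?_
    · intro k hk; simp at hk ⊢; exact hmem k hk
    · intro k hk; simp at hk ⊢; exact hmem k hk
    · intro k hk; simp at hk ⊢; exact hinv k hk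
    · intro k hk; simp at hk ⊢; exact hinv k hk
    · intro k hk'; simp at hk'; exact (hk k hk').symm
  rw [hW, hsum, hm1, sum_comp_sq hq (fun x => φ (x - 1) * Lsum x)]
  simp_rw [add_mul, one_mul, Finset.sum_add_distrib]
  rw [phi_L_sum1 hq, Ssum]
  rw [neg_add_cancel_left]
  refine Finset.sum_congr rfl fun v _ => ?_
  ring
/-- Twice the indicator of nonzero squares. -/
def psi (x : F) : ℤ := φ x + φ x * φ x

local notation "ψ" => psi

lemma psi_ne (x : F) (h : x ≠ 0) : ψ x = 1 + φ x := by
  rw [psi, phi_sq x h]; ring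

lemma psi_zero : ψ (0 : F) = 0 := by
  simp [psi]

lemma inner_P (hq : Fintype.card F % 4 = 1) (x : F) (h0 : x ≠ 0) (h1 : x ≠ 1) :
    ∑ y : F, ψ y * ψ (y - 1) * ψ (y - x) =
      (Fintype.card F : ℤ) - 8 - 3 * φ x - 3 * φ (x - 1) - φ x * φ (x - 1) + Lsum x := by
  have key : ∀ y : F, ψ y * ψ (y - 1) * ψ (y - x) =
      1 + φ y + φ (y - 1) + φ (y - x) + φ y * φ (y - 1) + φ y * φ (y - x)
      + φ (y - 1) * φ (y - x) + φ y * φ (y - 1) * φ (y - x)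
      - (if y = 0 then 2 * (1 + φ x) else 0)
      - (if y = 1 then 2 * (1 + φ (x - 1)) else 0)
      - (if y = x then (1 + φ x) * (1 + φ (x - 1)) else 0) := by
    intro y
    by_cases hy0 : y = 0
    · subst hy0
      rw [if_pos rfl, if_neg zero_ne_one, if_neg h0.symm, psi_zero, zero_sub, zero_sub,
        phi_neg hq, phi_neg hq, map_one, quadraticChar_zero]
      ring
    by_cases hy1 : y = 1
    · subst hy1
      rw [if_neg hy0, if_pos rfl, if_neg h1.symm, sub_self, psi_zero, phi_sub_comm hq 1 x,
        map_one, quadraticChar_zero]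
      ring
    by_cases hyx : y = x
    · subst hyx
      rw [if_neg hy0, if_neg hy1, if_pos rfl, sub_self, psi_zero, quadraticChar_zero]
      ring
    rw [if_neg hy0, if_neg hy1, if_neg hyx, psi_ne _ hy0, psi_ne _ (sub_ne_zero.mpr hy1),
      psi_ne _ (sub_ne_zero.mpr hyx)]
    ring
  simp_rw [key, Finset.sum_sub_distrib, Finset.sum_add_distrib, Finset.sum_ite_eq' univ,
    if_pos (Finset.mem_univ _), phi_sum hq, phi_sum_sub hq, phi_quad0 hq 1 one_ne_zero,
    phi_quad0 hq x h0, phi_sum_quad hq 1 x, if_neg h1.symm]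
  rw [← Lsum]
  simp
  ring

/-- The normalized clique sum. -/
def Psum (F : Type*) [Field F] [Fintype F] [DecidableEq F] : ℤ :=
  ∑ x : F, ∑ y : F, psi x * psi (x - 1) * (psi y * psi (y - 1) * psi (y - x))

lemma P_eq (hq : Fintype.card F % 4 = 1) :
    Psum F = (Fintype.card F : ℤ) ^ 2 - 20 * Fintype.card F + 81 + Ssum F := by
  have key : ∀ x : F, ∑ y : F, ψ x * ψ (x - 1) * (ψ y * ψ (y - 1) * ψ (y - x)) =
      ((Fintype.card F : ℤ) - 15) * (1 + φ x + φ (x - 1) + φ x * φ (x - 1)) +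
      (Lsum x + φ x * Lsum x + φ (x - 1) * Lsum x + φ x * φ (x - 1) * Lsum x)
      - (if x = 0 then 2 * ((Fintype.card F : ℤ) - 16) else 0)
      - (if x = 1 then 2 * ((Fintype.card F : ℤ) - 16) else 0) := by
    intro x
    rw [← Finset.mul_sum]
    by_cases hy0 : x = 0
    · subst hy0
      rw [if_pos rfl, if_neg zero_ne_one, psi_zero, zero_sub,
        phi_neg hq, map_one, quadraticChar_zero, L_zero hq]
      ring
    by_cases hy1 : x = 1
    · subst hy1
      rw [if_neg hy0, if_pos rfl, sub_self, psi_zero, L_one hq,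
        map_one, quadraticChar_zero]
      ring
    rw [if_neg hy0, if_neg hy1, psi_ne _ hy0, psi_ne _ (sub_ne_zero.mpr hy1),
      inner_P hq x hy0 hy1]
    have a1 := phi_sq x hy0
    have a2 := phi_sq (x - 1) (sub_ne_zero.mpr hy1)
    generalize φ x = X at *
    generalize φ (x - 1) = Y at *
    linear_combination (-3 - 4 * Y - Y ^ 2) * a1 + (-4 - 4 * X) * a2
  unfold Psum
  simp_rw [key, Finset.sum_sub_distrib, Finset.sum_add_distrib, ← Finset.mul_sum,
    Finset.sum_add_distrib, Finset.sum_ite_eq' univ,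
    if_pos (Finset.mem_univ _), phi_sum hq, phi_sum_sub hq, phi_quad0 hq (1 : F) one_ne_zero,
    phi_L_sum0 hq, phi_L_sum1 hq, L_sum hq]
  rw [← Ssum]
  simp
  ring

lemma P_eq' (hq : Fintype.card F % 4 = 1) :
    Psum F = (Fintype.card F : ℤ) ^ 2 - 22 * Fintype.card F + 81 + Jac (1 : F) ^ 2 := by
  rw [P_eq hq, ← W_eq_S hq, W_eq hq]; ring

lemma Jac_scale (t n : F) (ht : t ≠ 0) : Jac (t ^ 2 * n) = φ t * Jac n := by
  unfold Jac
  rw [← sum_affine _ t 0 ht, Finset.mul_sum]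
  refine Finset.sum_congr rfl fun r _ => ?_
  have e1 : (t * r + 0) ^ 2 + t ^ 2 * n = t ^ 2 * (r ^ 2 + n) := by ring
  rw [e1, phi_mul_sq _ _ ht, add_zero, map_mul]
  ring

lemma Jac_zero (hq : Fintype.card F % 4 = 1) : Jac (0 : F) = 0 := by
  unfold Jac
  have : ∀ r : F, φ r * φ (r ^ 2 + 0) = φ r := by
    intro r
    by_cases hr : r = 0
    · subst hr; simp
    · rw [add_zero, quadraticChar_sq_one' hr, mul_one]
  simp_rw [this, phi_sum hq]

lemma Jac_sq_sum (hq : Fintype.card F % 4 = 1) :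
    ∑ n : F, Jac n ^ 2 = 2 * Fintype.card F * ((Fintype.card F : ℤ) - 1) := by
  have h2 := two_ne_zero_F hq
  unfold Jac
  simp_rw [sq (∑ _, _), Finset.sum_mul_sum]
  rw [Finset.sum_comm]
  have : ∀ x : F, ∑ n : F, ∑ y : F, φ x * φ (x ^ 2 + n) * (φ y * φ (y ^ 2 + n)) =
      2 * Fintype.card F * (φ x * φ x) := by
    intro x
    by_cases hx : x = 0
    · subst hx; simp
    have hne : x ≠ -x := by
      intro h
      have : 2 * x = 0 := by linear_combination h
      exact mul_ne_zero h2 hx this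
    rw [Finset.sum_comm]
    have h1 : ∀ y : F, ∑ n : F, φ x * φ (x ^ 2 + n) * (φ y * φ (y ^ 2 + n)) =
      - φ x * φ y + Fintype.card F * ((if y = x then φ x * φ y else 0)
        + (if y = -x then φ x * φ y else 0)) := by
      intro y
      have h := phi_sum_quad hq (-x ^ 2) (-y ^ 2)
      have e : ∑ n : F, φ x * φ (x ^ 2 + n) * (φ y * φ (y ^ 2 + n)) =
          φ x * φ y * ∑ t : F, φ (t - -x ^ 2) * φ (t - -y ^ 2) := by
        rw [Finset.mul_sum]
        refine Finset.sum_congr rfl fun t _ => ?_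
        rw [sub_neg_eq_add, sub_neg_eq_add, add_comm t, add_comm t]
        ring
      rw [e, h]
      by_cases a1 : y = x
      · subst a1
        rw [if_pos rfl, if_pos rfl, if_neg hne]; ring
      by_cases a2 : y = -x
      · subst a2
        rw [if_pos (by ring), if_neg a1, if_pos rfl]; ring
      rw [if_neg a1, if_neg a2, if_neg]
      · ring
      · intro h
        rcases sq_eq_sq_iff_eq_or_eq_neg.mp (neg_injective h).symm with h | h
        · exact a1 h
        · exact a2 h
    simp_rw [h1, Finset.sum_add_distrib, ← Finset.mul_sum, Finset.sum_add_distrib,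
      Finset.sum_ite_eq' univ, if_pos (Finset.mem_univ _), phi_sum hq, phi_neg hq]
    ring
  simp_rw [this]
  rw [← Finset.mul_sum, phi_sq_sum]

lemma Jac_relation (hq : Fintype.card F % 4 = 1) :
    ∃ c : ℤ, Jac (1 : F) ^ 2 + c ^ 2 = 4 * Fintype.card F := by
  obtain ⟨n, hn⟩ := quadraticChar_exists_neg_one (ringChar_ne_two hq)
  refine ⟨Jac n, ?_⟩
  have hn0 : n ≠ 0 := by
    rintro rfl
    simp at hn
  have key : ∀ x : F, 2 * Jac x ^ 2 = (1 + φ x) * Jac (1 : F) ^ 2 + (1 - φ x) * Jac n ^ 2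
      - if x = 0 then Jac (1 : F) ^ 2 + Jac n ^ 2 else 0 := by
    intro x
    by_cases hx : x = 0
    · subst hx
      rw [if_pos rfl, quadraticChar_zero, Jac_zero hq]; ring
    rw [if_neg hx]
    rcases quadraticChar_dichotomy hx with h | h
    · rw [h]
      obtain ⟨t, ht⟩ := (quadraticChar_one_iff_isSquare hx).mp h
      have ht0 : t ≠ 0 := by
        rintro rfl; simp at ht; exact hx ht
      have : x = t ^ 2 * 1 := by rw [ht]; ring
      rw [this, Jac_scale t 1 ht0]
      linear_combination 2 * Jac (1 : F) ^ 2 * phi_sq t ht0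
    · have hs : φ (x / n) = 1 := by
        have : φ (x / n) * φ n = φ x := by rw [← map_mul, div_mul_cancel₀ _ hn0]
        rw [hn, h] at this; linarith
      rw [h]
      obtain ⟨t, ht⟩ := (quadraticChar_one_iff_isSquare (div_ne_zero hx hn0)).mp hs
      have ht0 : t ≠ 0 := by
        rintro rfl; simp [hx, hn0] at ht
      have : x = t ^ 2 * n := by rw [sq, ← ht, div_mul_cancel₀ _ hn0]
      rw [this, Jac_scale t n ht0]
      linear_combination 2 * Jac n ^ 2 * phi_sq t ht0
  have h := Finset.sum_congr (rfl : (univ : Finset F) = univ) (fun x _ => key x)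
  rw [← Finset.mul_sum, Jac_sq_sum hq, Finset.sum_sub_distrib, Finset.sum_add_distrib,
    ← Finset.sum_mul, ← Finset.sum_mul, Finset.sum_add_distrib, Finset.sum_sub_distrib,
    phi_sum hq, Finset.sum_ite_eq' univ, if_pos (Finset.mem_univ _)] at h
  simp only [sum_const, card_univ, nsmul_eq_mul, mul_one, add_zero, sub_zero] at h
  have hc : (Fintype.card F : ℤ) - 1 ≠ 0 := by
    have := Fintype.one_lt_card (α := F)
    omega
  apply mul_left_cancel₀ hc
  linear_combination -h
lemma Jac_mod_four (hq : Fintype.card F % 4 = 1) : Jac (1 : F) % 4 = 2 := by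
  have h2 := two_ne_zero_F hq
  have h4 : φ (4 : F) = 1 := by
    have := quadraticChar_sq_one' h2
    norm_num at this ⊢; exact this
  have hne : (2 : F) ≠ -2 := by
    intro h
    have : (2 : F) * 2 = 0 := by linear_combination h
    exact mul_ne_zero h2 h2 this
  have e1 : Jac (1 : F) = ∑ v : F, (1 + φ (v ^ 2 - 4)) * φ v := by
    have := sum_comp_joukowski hq (1 : F) one_ne_zero (fun v => φ v)
    rw [mul_one] at this
    rw [← this, Jac, Finset.sum_filter]
    refine Finset.sum_congr rfl fun m _ => ?_
    by_cases hm : m = 0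
    · subst hm; simp
    · rw [if_pos hm, ← phi_mul_sq m (m + 1 / m) hm, ← map_mul]
      congr 1
      field_simp
  have e2 : ∑ v : F, φ (v ^ 2 - 4) = -1 := by
    have := phi_sum_quad hq (2 : F) (-2)
    rw [if_neg hne] at this
    rw [← this]
    refine Finset.sum_congr rfl fun m _ => ?_
    rw [← map_mul]
    congr 1
    ring
  have key : ∀ v : F, (4 : ℤ) ∣ (1 + φ (v ^ 2 - 4)) * φ v - (1 + φ (v ^ 2 - 4))
      + (if v = 0 then 2 else 0) + (if v = 2 then 1 - φ (2 : F) else 0)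
      + (if v = -2 then 1 - φ (2 : F) else 0) := by
    intro v
    by_cases a0 : v = 0
    · subst a0
      rw [if_pos rfl, if_neg h2.symm, if_neg (by simpa using h2)]
      have : (0 : F) ^ 2 - 4 = -4 := by ring
      rw [this, phi_neg hq, h4, quadraticChar_zero]
      norm_num
    by_cases a1 : v = 2
    · subst a1
      rw [if_neg a0, if_pos rfl, if_neg hne]
      have : (2 : F) ^ 2 - 4 = 0 := by ring
      rw [this, quadraticChar_zero]
      ring_nf; simp
    by_cases a2 : v = -2
    · subst a2
      rw [if_neg a0, if_neg a1, if_pos rfl]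
      have : (-2 : F) ^ 2 - 4 = 0 := by ring
      rw [this, quadraticChar_zero, phi_neg hq]
      ring_nf; simp
    rw [if_neg a0, if_neg a1, if_neg a2]
    have hv : v ^ 2 - 4 ≠ 0 := by
      have : v ^ 2 - 4 = (v - 2) * (v - -2) := by ring
      rw [this]
      exact mul_ne_zero (sub_ne_zero.mpr a1) (sub_ne_zero.mpr a2)
    rcases quadraticChar_dichotomy a0 with h | h <;>
    rcases quadraticChar_dichotomy hv with h' | h' <;> rw [h, h'] <;> norm_num
  have hs := Finset.dvd_sum (s := (univ : Finset F)) (fun v _ => key v)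
  simp_rw [Finset.sum_add_distrib, Finset.sum_sub_distrib, ← e1, Finset.sum_add_distrib, e2,
    Finset.sum_ite_eq' univ, if_pos (Finset.mem_univ _)] at hs
  simp only [sum_const, card_univ, nsmul_eq_mul, mul_one] at hs
  rcases quadraticChar_dichotomy h2 with h | h <;> rw [h] at hs <;> omega

lemma sum_pow_F (i : ℕ) (hi : i ≠ 0) :
    ∑ x : F, x ^ i = if Fintype.card F - 1 ∣ i then -1 else 0 := by
  rw [← FiniteField.sum_pow_units, ← Finset.add_sum_erase univ _ (Finset.mem_univ (0 : F)),
    zero_pow hi, zero_add]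
  symm
  refine Finset.sum_bij (fun u _ => (u : F)) ?_ ?_ ?_ ?_
  · intro u _; simp
  · intro a _ b _ h; exact Units.ext h
  · intro b hb; simp at hb; exact ⟨Units.mk0 b hb, by simp, rfl⟩
  · intro u _; rfl

lemma Jac_cast (hq : Fintype.card F % 4 = 1) (n : ℕ) (hn : Fintype.card F = 4 * n + 1) :
    ((Jac (1 : F) : ℤ) : F) = - ((2 * n).choose n : F) := by
  have hm : Fintype.card F / 2 = 2 * n := by omega
  have hn0 : n ≠ 0 := by
    rintro rfl
    have := Fintype.one_lt_card (α := F)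
    omega
  unfold Jac
  push_cast
  have h1 : ∀ x : F, ((φ x : ℤ) : F) * ((φ (x ^ 2 + 1) : ℤ) : F) =
      ∑ j ∈ Finset.range (2 * n + 1), ((2 * n).choose j : F) * x ^ (2 * n + 2 * j) := by
    intro x
    rw [quadraticChar_eq_pow_of_char_ne_two' (ringChar_ne_two hq),
      quadraticChar_eq_pow_of_char_ne_two' (ringChar_ne_two hq), hm, add_pow, Finset.mul_sum]
    refine Finset.sum_congr rfl fun j _ => ?_
    rw [one_pow, pow_add, pow_mul x 2 j]
    ring
  simp_rw [h1]
  rw [Finset.sum_comm]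
  simp_rw [← Finset.mul_sum]
  rw [Finset.sum_eq_single n]
  · rw [sum_pow_F _ (by omega), if_pos]
    · ring
    · rw [hn]; exact ⟨1, by omega⟩
  · intro j hj hjn
    rw [sum_pow_F _ (by omega), if_neg, mul_zero]
    rw [hn, Finset.mem_range] at *
    rintro ⟨k, hk⟩
    have hk' : 2 * n + 2 * j = 4 * n * k := by simpa using hk
    have : k < 2 := by
      by_contra h
      have : 4 * n * 2 ≤ 4 * n * k := Nat.mul_le_mul_left _ (by omega)
      omega
    interval_cases k <;> omega
  · intro h; simp at h; omega

end paley

lemma choose_not_dvd (p : ℕ) (hp : p.Prime) (hp4 : p % 4 = 1) (ℓ : ℕ) :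
    ∀ n, p ^ ℓ = 4 * n + 1 → ¬ p ∣ (2 * n).choose n := by
  have := Fact.mk hp
  induction ℓ with
  | zero =>
    intro n hn
    have : n = 0 := by simpa using hn
    subst this
    simpa using hp.one_lt.ne'
  | succ l ih =>
    intro n hn
    have hl : (p ^ l) % 4 = 1 := by
      simp [Nat.pow_mod, hp4]
    obtain ⟨m, hm⟩ : ∃ m, p ^ l = 4 * m + 1 := ⟨p ^ l / 4, by omega⟩
    obtain ⟨k, hk⟩ : ∃ k, p = 4 * k + 1 := ⟨p / 4, by omega⟩
    have hnn : n = k + p * m := by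
      rw [pow_succ, hm] at hn
      have : 4 * n + 1 = 4 * (k + p * m) + 1 := by
        rw [← hn]
        nlinarith
      omega
    have h := Choose.choose_modEq_choose_mod_mul_choose_div_nat (p := p) (n := 2 * n) (k := n)
    have h1 : (2 * n) = 2 * k + p * (2 * m) := by rw [hnn]; ring
    have hpp := hp.pos
    have e1 : (2 * n) % p = 2 * k := by
      rw [h1, Nat.add_mul_mod_self_left, Nat.mod_eq_of_lt (by omega)]
    have e2 : (2 * n) / p = 2 * m := by
      rw [h1, Nat.add_mul_div_left _ _ hpp, Nat.div_eq_of_lt (by omega), zero_add]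
    have e3 : n % p = k := by
      rw [hnn, Nat.add_mul_mod_self_left, Nat.mod_eq_of_lt (by omega)]
    have e4 : n / p = m := by
      rw [hnn, Nat.add_mul_div_left _ _ hpp, Nat.div_eq_of_lt (by omega), zero_add]
    rw [e1, e2, e3, e4] at h
    rw [h.dvd_iff dvd_rfl, hp.dvd_mul]
    rintro (h | h)
    · have h3 : (2 * k).choose k ∣ (2 * k).factorial := by
        rw [← Nat.choose_mul_factorial_mul_factorial (n := 2 * k) (k := k) (by omega), mul_assoc]
        exact dvd_mul_right _ _
      have := (hp.dvd_factorial).mp (h.trans h3)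
      omega
    · exact ih m hm h

lemma two_sq_unique (p : ℕ) (hp : p.Prime) (hp2 : p % 2 = 1) (l : ℕ) (a b c d : ℤ)
    (h1 : a ^ 2 + b ^ 2 = (p : ℤ) ^ l) (h2 : c ^ 2 + d ^ 2 = (p : ℤ) ^ l)
    (hl : 1 ≤ l)
    (ha : ¬ (p : ℤ) ∣ a) (hc : ¬ (p : ℤ) ∣ c) (ha2 : a % 2 = 1) (hc2 : c % 2 = 1) :
    a ^ 2 = c ^ 2 := by
  have hpi : Prime (p : ℤ) := Nat.prime_iff_prime_int.mp hp
  have hpl : (p : ℤ) ∣ (p : ℤ) ^ l := dvd_pow_self _ (by omega)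
  have hodd : ((p : ℤ) ^ l) % 2 = 1 := by
    have : Odd ((p : ℤ) ^ l) := Odd.pow (by rw [Int.odd_iff]; omega)
    exact Int.odd_iff.mp this
  have hd : ¬ (p : ℤ) ∣ d := by
    intro h
    apply hc
    apply hpi.dvd_of_dvd_pow (n := 2)
    have : c ^ 2 = (p : ℤ) ^ l - d ^ 2 := by linarith
    rw [this]
    exact dvd_sub hpl (dvd_pow h (by norm_num))
  have par : ∀ x y : ℤ, x % 2 = 1 → (x ^ 2 + y ^ 2) % 2 = 1 → Even y := by
    intro x y hx hxy
    by_contra hy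
    rw [Int.not_even_iff_odd] at hy
    have hx' : Odd x := Int.odd_iff.mpr hx
    have : Even (x ^ 2 + y ^ 2) := (hx'.pow).add_odd (hy.pow)
    rw [Int.even_iff] at this
    omega
  have hb2 : Even b := par a b ha2 (by rw [h1]; exact hodd)
  have hd2 : Even d := par c d hc2 (by rw [h2]; exact hodd)
  have hprod : (a * d - b * c) * (a * d + b * c) = (p : ℤ) ^ l * (a ^ 2 - c ^ 2) := by
    linear_combination a ^ 2 * h2 - c ^ 2 * h1
  have main : ∀ u v : ℤ, Even u → u * v = (p : ℤ) ^ l * (a ^ 2 - c ^ 2) → (p : ℤ) ^ l ∣ u →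
      u ^ 2 ≤ ((p : ℤ) ^ l) ^ 2 → a ^ 2 = c ^ 2 := by
    intro u v hu huv hdv hle
    obtain ⟨k, hk⟩ := hdv
    have hpos : (0 : ℤ) < (p : ℤ) ^ l := pow_pos (by exact_mod_cast hp.pos) _
    have hk1 : k ^ 2 ≤ 1 := by
      rw [hk, mul_pow] at hle
      have : 0 < ((p : ℤ) ^ l) ^ 2 := by positivity
      nlinarith
    have hke : Even k := by
      rw [hk, Int.even_mul] at hu
      rcases hu with h | h
      · rw [Int.even_iff] at h; omega
      · exact h
    have hk0 : k = 0 := by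
      obtain ⟨j, hj⟩ := hke
      subst hj
      have : j ^ 2 < 1 := by nlinarith
      have : j = 0 := by nlinarith [sq_nonneg j, pow_eq_zero_iff (two_ne_zero) |>.mp (le_antisymm (by omega : j ^ 2 ≤ 0) (sq_nonneg j))]
      omega
    subst hk0
    rw [hk, mul_zero, zero_mul] at huv
    have := (mul_eq_zero.mp huv.symm).resolve_left hpos.ne'
    linarith
  have le1 : (a * d - b * c) ^ 2 ≤ ((p : ℤ) ^ l) ^ 2 := by
    have : (a * d - b * c) ^ 2 + (a * c + b * d) ^ 2 = ((p : ℤ) ^ l) ^ 2 := by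
      rw [sq ((p : ℤ) ^ l)]; nth_rewrite 1 [← h1]; rw [← h2]; ring
    nlinarith [sq_nonneg (a * c + b * d)]
  have le2 : (a * d + b * c) ^ 2 ≤ ((p : ℤ) ^ l) ^ 2 := by
    have : (a * d + b * c) ^ 2 + (a * c - b * d) ^ 2 = ((p : ℤ) ^ l) ^ 2 := by
      rw [sq ((p : ℤ) ^ l)]; nth_rewrite 1 [← h1]; rw [← h2]; ring
    nlinarith [sq_nonneg (a * c - b * d)]
  have ev1 : Even (a * d - b * c) := (hd2.mul_left a).sub (hb2.mul_right c)
  have ev2 : Even (a * d + b * c) := (hd2.mul_left a).add (hb2.mul_right c)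
  by_cases hx : (p : ℤ) ∣ a * d - b * c
  · have hy : ¬ (p : ℤ) ∣ a * d + b * c := by
      intro hy
      have h3 : (p : ℤ) ∣ 2 * (a * d) := by
        have := dvd_add hx hy
        have e : a * d - b * c + (a * d + b * c) = 2 * (a * d) := by ring
        rwa [e] at this
      rcases hpi.dvd_mul.mp h3 with h | h
      · have := (Nat.prime_dvd_prime_iff_eq hp Nat.prime_two).mp (by exact_mod_cast h)
        omega
      · rcases hpi.dvd_mul.mp h with h | h
        · exact ha h
        · exact hd h
    have hcop : IsCoprime ((p : ℤ) ^ l) (a * d + b * c) :=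
      ((Prime.coprime_iff_not_dvd hpi).mpr hy).pow_left
    have : (p : ℤ) ^ l ∣ a * d - b * c :=
      hcop.dvd_of_dvd_mul_right (by rw [hprod]; exact dvd_mul_right _ _)
    exact main _ _ ev1 hprod this le1
  · have hcop : IsCoprime ((p : ℤ) ^ l) (a * d - b * c) :=
      ((Prime.coprime_iff_not_dvd hpi).mpr hx).pow_left
    have : (p : ℤ) ^ l ∣ a * d + b * c :=
      hcop.dvd_of_dvd_mul_left (by rw [hprod]; exact dvd_mul_right _ _)
    exact main _ _ ev2 (by rw [mul_comm]; exact hprod) this le2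

section clique
variable {F : Type*} [Field F] [Fintype F] [DecidableEq F]

lemma paley_adj (hq : Fintype.card F % 4 = 1) (x y : F) :
    (paleyGraph F 2).Adj x y ↔ quadraticChar F (y - x) = 1 := by
  have key : ∀ a b : F, a ≠ b → ((∃ z : F, z ≠ 0 ∧ b - a = z ^ 2) ↔ quadraticChar F (b - a) = 1) := by
    intro a b hab
    have h0 : b - a ≠ 0 := sub_ne_zero.mpr hab.symm
    rw [quadraticChar_one_iff_isSquare h0]
    constructor
    · rintro ⟨z, _, hz⟩
      exact ⟨z, by rw [hz, sq]⟩
    · rintro ⟨z, hz⟩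
      refine ⟨z, ?_, by rw [hz, sq]⟩
      rintro rfl
      rw [mul_zero] at hz
      exact h0 hz
  unfold paleyGraph
  rw [SimpleGraph.fromRel_adj]
  by_cases hxy : x = y
  · subst hxy; simp
  · rw [key x y hxy, key y x (Ne.symm hxy), phi_sub_comm hq x y]
    simp [hxy]

lemma psi_eq (x : F) : psi x = if quadraticChar F x = 1 then 2 else 0 := by
  by_cases h : x = 0
  · subst h; simp [psi]
  · rw [psi_ne x h]
    rcases quadraticChar_dichotomy h with h | h <;> rw [h] <;> norm_num

open Classical in
/-- Ordered cliques. -/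
noncomputable def ordClique (G : SimpleGraph F) : Finset (Fin 4 → F) :=
  univ.filter fun f => ∀ i j, i < j → G.Adj (f i) (f j)

lemma ordClique_card (G : SimpleGraph F) : (ordClique G).card = 24 * G.cliqueCount 4 := by
  classical
  have hpair : ∀ f ∈ ordClique G, ∀ i j, i ≠ j → G.Adj (f i) (f j) := by
    intro f hf i j hij
    simp only [ordClique, mem_filter, mem_univ, true_and] at hf
    rcases lt_or_gt_of_ne hij with h | h
    · exact hf i j h
    · exact (hf j i h).symm
  have hinj : ∀ f ∈ ordClique G, Function.Injective f := by
    intro f hf i j hij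
    by_contra h
    exact (hpair f hf i j h).ne hij
  have hK : G.cliqueCount 4 = (univ.filter fun s : Finset F => G.IsNClique 4 s).card := by
    unfold SimpleGraph.cliqueCount
    rw [Nat.card_eq_fintype_card, Fintype.card_subtype]
  rw [hK, Finset.card_eq_sum_card_fiberwise (f := fun f : Fin 4 → F => univ.image f)
    (t := univ.filter fun s : Finset F => G.IsNClique 4 s)]
  · rw [Finset.sum_const_nat (m := 24)]
    · ring
    · intro s hs
      simp only [mem_filter, mem_univ, true_and] at hs
      have hcard : s.card = 4 := hs.card_eq
      have e0 : Fin 4 ≃ s := (Finset.equivFinOfCardEq hcard).symm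
      have h24 : (univ : Finset (Fin 4 ≃ s)).card = 24 := by
        rw [Finset.card_univ, Fintype.card_equiv e0]
        rfl
      rw [← h24]
      symm
      refine Finset.card_bij (fun e _ => fun i => ((e i : s) : F)) ?_ ?_ ?_
      · intro e _
        simp only [mem_filter, ordClique, mem_univ, true_and]
        constructor
        · intro i j hij
          apply hs.isClique (e i).2 (e j).2
          intro h
          exact hij.ne (e.injective (Subtype.ext h))
        · ext x
          simp only [mem_image, mem_univ, true_and]
          constructor
          · rintro ⟨i, rfl⟩; exact (e i).2
          · intro hx
            exact ⟨e.symm ⟨x, hx⟩, by simp⟩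
      · intro e _ e' _ h
        ext i
        exact congrFun h i
      · intro f hf
        rw [mem_filter] at hf
        obtain ⟨hf1, hf2⟩ := hf
        have hm : ∀ i, f i ∈ s := by
          intro i; rw [← hf2]; exact mem_image_of_mem _ (mem_univ _)
        refine ⟨Equiv.ofBijective (fun i => (⟨f i, hm i⟩ : s)) ⟨?_, ?_⟩, mem_univ _, rfl⟩
        · intro i j hij
          exact hinj f hf1 (congrArg Subtype.val hij)
        · rintro ⟨x, hx⟩
          rw [← hf2] at hx
          obtain ⟨i, _, hi⟩ := mem_image.mp hx
          exact ⟨i, Subtype.ext hi⟩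
  · intro f hf
    have hf' : f ∈ ordClique G := hf
    simp only [coe_filter, mem_univ, true_and, Set.mem_ofPred_eq]
    refine ⟨?_, ?_⟩
    · intro x hx y hy hxy
      simp only [coe_image, coe_univ, Set.image_univ, Set.mem_range] at hx hy
      obtain ⟨i, rfl⟩ := hx
      obtain ⟨j, rfl⟩ := hy
      exact hpair f hf' i j (fun h => hxy (by rw [h]))
    · rw [Finset.card_image_of_injective _ (hinj f hf')]; simp

/-- Four-tuples as a product. -/
def tupEquiv (F : Type*) : (Fin 4 → F) ≃ F × F × F × F where
  toFun f := (f 0, f 1, f 2, f 3)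
  invFun t := ![t.1, t.2.1, t.2.2.1, t.2.2.2]
  left_inv f := by ext i; fin_cases i <;> rfl
  right_inv t := rfl

lemma ordClique_sum (hq : Fintype.card F % 4 = 1) :
    (64 : ℤ) * (ordClique (paleyGraph F 2)).card = ∑ a : F, ∑ b : F, ∑ c : F, ∑ d : F,
      psi (b - a) * psi (c - a) * psi (d - a) * psi (c - b) * psi (d - b) * psi (d - c) := by
  have h1 : (64 : ℤ) * (ordClique (paleyGraph F 2)).card = ∑ f : Fin 4 → F,
      psi (f 1 - f 0) * psi (f 2 - f 0) * psi (f 3 - f 0) * psi (f 2 - f 1) * psi (f 3 - f 1)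
        * psi (f 3 - f 2) := by
    rw [ordClique, Finset.card_filter]
    push_cast
    rw [Finset.mul_sum]
    refine Finset.sum_congr rfl fun f _ => ?_
    have hiff : (∀ i j : Fin 4, i < j → (paleyGraph F 2).Adj (f i) (f j)) ↔
        (quadraticChar F (f 1 - f 0) = 1 ∧ quadraticChar F (f 2 - f 0) = 1 ∧
        quadraticChar F (f 3 - f 0) = 1 ∧ quadraticChar F (f 2 - f 1) = 1 ∧
        quadraticChar F (f 3 - f 1) = 1 ∧ quadraticChar F (f 3 - f 2) = 1) := by
      simp only [paley_adj hq]
      constructor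
      · intro h
        exact ⟨h 0 1 (by decide), h 0 2 (by decide), h 0 3 (by decide), h 1 2 (by decide),
          h 1 3 (by decide), h 2 3 (by decide)⟩
      · rintro ⟨h1, h2, h3, h4, h5, h6⟩ i j hij
        fin_cases i <;> fin_cases j <;> first | assumption | exact absurd hij (by decide)
    simp only [hiff, psi_eq]
    generalize quadraticChar F (f 1 - f 0) = x1
    generalize quadraticChar F (f 2 - f 0) = x2
    generalize quadraticChar F (f 3 - f 0) = x3
    generalize quadraticChar F (f 2 - f 1) = x4
    generalize quadraticChar F (f 3 - f 1) = x5
    generalize quadraticChar F (f 3 - f 2) = x6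
    by_cases h1 : x1 = 1 <;> by_cases h2 : x2 = 1 <;> by_cases h3 : x3 = 1 <;>
      by_cases h4 : x4 = 1 <;> by_cases h5 : x5 = 1 <;> by_cases h6 : x6 = 1 <;>
      simp [h1, h2, h3, h4, h5, h6]
  rw [h1, ← (tupEquiv F).symm.sum_comp]
  simp only [Fintype.sum_prod_type]
  rfl

lemma psi_sum (hq : Fintype.card F % 4 = 1) : ∑ x : F, psi x = (Fintype.card F : ℤ) - 1 := by
  simp only [psi, Finset.sum_add_distrib]
  rw [phi_sum hq, phi_sq_sum, zero_add]

lemma ordClique_sum' (hq : Fintype.card F % 4 = 1) :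
    (64 : ℤ) * (ordClique (paleyGraph F 2)).card =
      Fintype.card F * ((Fintype.card F - 1) * Psum F) := by
  rw [ordClique_sum hq]
  have hb : ∀ b : F, ∑ c : F, ∑ d : F,
      psi b * psi c * psi d * psi (c - b) * psi (d - b) * psi (d - c) = psi b * Psum F := by
    intro b
    by_cases h : quadraticChar F b = 1
    · have hb0 : b ≠ 0 := by rintro rfl; simp at h
      have hp : ∀ x : F, psi (b * x) = psi x := by
        intro x
        rw [psi, psi, map_mul, h, one_mul]
      rw [Psum, Finset.mul_sum, ← sum_affine _ b 0 hb0]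
      refine Finset.sum_congr rfl fun x _ => ?_
      rw [Finset.mul_sum, ← sum_affine _ b 0 hb0]
      refine Finset.sum_congr rfl fun y _ => ?_
      have e1 : b * x + 0 - b = b * (x - 1) := by ring
      have e2 : b * y + 0 - b = b * (y - 1) := by ring
      have e3 : b * y + 0 - (b * x + 0) = b * (y - x) := by ring
      rw [e1, e2, e3, add_zero, add_zero, hp, hp, hp, hp, hp]
      ring
    · have : psi b = 0 := by rw [psi_eq, if_neg h]
      simp [this]
  have ha : ∀ a : F, ∑ b : F, ∑ c : F, ∑ d : F,
      psi (b - a) * psi (c - a) * psi (d - a) * psi (c - b) * psi (d - b) * psi (d - c) =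
      (Fintype.card F - 1) * Psum F := by
    intro a
    rw [← psi_sum hq, Finset.sum_mul, ← sum_affine _ 1 a one_ne_zero]
    refine Finset.sum_congr rfl fun b _ => ?_
    rw [← hb, ← sum_affine _ 1 a one_ne_zero]
    refine Finset.sum_congr rfl fun c _ => ?_
    rw [← sum_affine _ 1 a one_ne_zero]
    refine Finset.sum_congr rfl fun d _ => ?_
    simp only [one_mul, add_sub_cancel_right, add_sub_add_right_eq_sub]
  simp_rw [ha]
  simp

end clique

end helpers

lemma gauss_pow (p : ℕ) (e f : ℤ) (hp : p.Prime) (hp4 : p % 4 = 1)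
    (hef : (p : ℤ) = e ^ 2 + 4 * f ^ 2) (he : e % 4 = 1) (hpe : ¬ (p : ℤ) ∣ e) (l : ℕ)
    (hl : 1 ≤ l) :
    ∃ A B : ℤ, ((e : ℂ) + 2 * (f : ℂ) * I) ^ l = A + B * I ∧
      ((e : ℂ) - 2 * (f : ℂ) * I) ^ l = A - B * I ∧ A ^ 2 + B ^ 2 = (p : ℤ) ^ l ∧
      A % 2 = 1 ∧ ¬ (p : ℤ) ∣ A := by
  have hI : (I : ℂ) ^ 2 = -1 := I_sq
  have hpi : Prime (p : ℤ) := Nat.prime_iff_prime_int.mp hp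
  have main : ∃ A B : ℤ, ((e : ℂ) + 2 * (f : ℂ) * I) ^ l = A + B * I ∧
      ((e : ℂ) - 2 * (f : ℂ) * I) ^ l = A - B * I ∧ A ^ 2 + B ^ 2 = (p : ℤ) ^ l ∧
      A % 2 = 1 ∧ B % 2 = 0 ∧ ¬ (p : ℤ) ∣ A ∧ (p : ℤ) ∣ e * A + 2 * f * B := by
    induction l, hl using Nat.le_induction with
    | base =>
      refine ⟨e, 2 * f, by push_cast; ring, by push_cast; ring, by rw [hef]; ring, by omega,
        by omega, hpe, ?_⟩
      rw [hef]; exact ⟨1, by ring⟩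
    | succ n hn ih =>
      obtain ⟨A, B, h1, h2, h3, h4, h5, h6, h7⟩ := ih
      refine ⟨e * A - 2 * f * B, e * B + 2 * f * A, ?_, ?_, ?_, ?_, ?_, ?_, ?_⟩
      · rw [pow_succ, h1]; push_cast; linear_combination (2 * f * B) * hI
      · rw [pow_succ, h2]; push_cast; linear_combination (2 * f * B) * hI
      · rw [pow_succ (p : ℤ), ← h3, hef]; ring
      · have : (e * A) % 2 = 1 := by
          rw [Int.mul_emod]; have : e % 2 = 1 := by omega
          rw [this, h4]; rfl
        rw [mul_assoc]; omega
      · have : (e * B) % 2 = 0 := by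
          rw [Int.mul_emod, h5]; simp
        rw [mul_assoc]; omega
      · intro h
        have h8 : (p : ℤ) ∣ 2 * (e * A) := by
          have := dvd_add h h7
          have e' : e * A - 2 * f * B + (e * A + 2 * f * B) = 2 * (e * A) := by ring
          rwa [e'] at this
        rcases hpi.dvd_mul.mp h8 with h | h
        · have := (Nat.prime_dvd_prime_iff_eq hp Nat.prime_two).mp (by exact_mod_cast h)
          omega
        · rcases hpi.dvd_mul.mp h with h | h
          · exact hpe h
          · exact h6 h
      · rw [hef]
        exact ⟨A, by ring⟩
  obtain ⟨A, B, h1, h2, h3, h4, -, h6, -⟩ := main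
  exact ⟨A, B, h1, h2, h3, h4, h6⟩

/-- Let `p ≡ 1 (mod 4)` be prime with `p = e₁² + 4f₁²`, `e₁ ≡ 1 (mod 4)`, `p ∤ e₁`. With
`f_ℓ = Im((e₁+2f₁·i)^ℓ) = -(i/4)(e₁+2f₁·i)^ℓ + (i/4)(e₁-2f₁·i)^ℓ`, the number of `4`-cliques
in the Paley graph `Γ(2, p^ℓ)` is `p^ℓ(p^ℓ-1)((p^ℓ-9)² - 16f_ℓ²)/(2⁹·3)` for `ℓ ≥ 1`. -/
theorem fourCliqueCount_paley_two_ext (p : ℕ) (e₁ f₁ : ℤ)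
    (hp : p.Prime) (hp4 : p % 4 = 1)
    (hef : (p : ℤ) = e₁ ^ 2 + 4 * f₁ ^ 2) (he4 : e₁ % 4 = 1) (hpe : ¬ (p : ℤ) ∣ e₁)
    (ℓ : ℕ) (hℓ : 1 ≤ ℓ)
    (F : Type*) [Field F] [Fintype F] (hF : Fintype.card F = p ^ ℓ) :
    (2 ^ 9 * 3 : ℂ) * ((paleyGraph F 2).cliqueCount 4 : ℂ) =
      (p : ℂ) ^ ℓ * ((p : ℂ) ^ ℓ - 1) *
        (((p : ℂ) ^ ℓ - 9) ^ 2 -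
          16 * (-(I / 4) * ((e₁ : ℂ) + 2 * (f₁ : ℂ) * I) ^ ℓ +
            (I / 4) * ((e₁ : ℂ) - 2 * (f₁ : ℂ) * I) ^ ℓ) ^ 2) := by
  classical
  have := Fact.mk hp
  have : CharP F p := charP_of_card_eq_prime_pow hF
  have hq : Fintype.card F % 4 = 1 := by
    rw [hF]; simp [Nat.pow_mod, hp4]
  obtain ⟨n, hn⟩ : ∃ n, p ^ ℓ = 4 * n + 1 := ⟨p ^ ℓ / 4, by rw [hF] at hq; omega⟩
  obtain ⟨A, B, hA1, hA2, hAB, hAodd, hpA⟩ := gauss_pow p e₁ f₁ hp hp4 hef he4 hpe ℓ hℓ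
  obtain ⟨c, hc⟩ := Jac_relation (F := F) hq
  have hJ4 := Jac_mod_four (F := F) hq
  have hJp : ¬ (p : ℤ) ∣ Jac (1 : F) := by
    intro h
    have h0 : ((Jac (1 : F) : ℤ) : F) = 0 := (CharP.intCast_eq_zero_iff F p _).mpr h
    rw [Jac_cast hq n (hF.trans hn), neg_eq_zero, CharP.cast_eq_zero_iff F p] at h0
    exact choose_not_dvd p hp hp4 ℓ n hn h0
  obtain ⟨a, ha⟩ : ∃ a : ℤ, Jac (1 : F) = 2 * a := ⟨Jac (1 : F) / 2, by omega⟩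
  have hce : Even c := by
    have : Even (c ^ 2) := by
      have : c ^ 2 = 2 * (2 * (Fintype.card F - a ^ 2)) := by rw [ha] at hc; linarith
      rw [this]; exact even_two_mul _
    exact (Int.even_pow.mp this).1
  obtain ⟨d, hd⟩ := hce
  have had : a ^ 2 + d ^ 2 = (p : ℤ) ^ ℓ := by
    have hF' : (Fintype.card F : ℤ) = (p : ℤ) ^ ℓ := by rw [hF]; push_cast; rfl
    rw [hF', ha, hd] at hc
    linarith
  have huniq : a ^ 2 = A ^ 2 := by
    refine two_sq_unique p hp (by omega) ℓ a d A B had hAB hℓ ?_ hpA (by omega) hAodd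
    intro h
    exact hJp (by rw [ha]; exact h.mul_left 2)
  have hcount : (2 ^ 9 * 3 : ℤ) * ((paleyGraph F 2).cliqueCount 4 : ℤ) =
      (p : ℤ) ^ ℓ * ((p : ℤ) ^ ℓ - 1) * (((p : ℤ) ^ ℓ - 9) ^ 2 - 4 * B ^ 2) := by
    have h1 := ordClique_sum' (F := F) hq
    rw [ordClique_card, P_eq' hq, ha, hF] at h1
    push_cast at h1
    have hB : B ^ 2 = (p : ℤ) ^ ℓ - a ^ 2 := by rw [huniq]; linarith
    rw [hB]
    linear_combination h1
  have hcC : (2 ^ 9 * 3 : ℂ) * ((paleyGraph F 2).cliqueCount 4 : ℂ) =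
      (p : ℂ) ^ ℓ * ((p : ℂ) ^ ℓ - 1) * (((p : ℂ) ^ ℓ - 9) ^ 2 - 4 * (B : ℂ) ^ 2) := by
    exact_mod_cast hcount
  rw [hcC, hA1, hA2]
  have hI : (I : ℂ) ^ 2 = -1 := I_sq
  have : -(I / 4) * ((A : ℂ) + B * I) + I / 4 * (A - B * I) = B / 2 := by
    linear_combination (-(B : ℂ) / 2) * hI
  rw [this]
  ring
end

section
/- Let p be a prime with p ≡ 1 (mod 4), let α ≥ 1, and write p = x² + 4y² with x, y ∈ ℤ. Let ψ be a Dirichlet character modulo p^α of order 4 and φ the Dirichlet character modulo p^α of order 2, and let J(ψ,φ) = Σ_{a ∈ ℤ/p^αℤ} ψ(a) φ(1−a) be their Jacobi sum (with the characters extended by 0 on non-units). Then J(ψ,φ)² + conj(J(ψ,φ))² = 2 p^(2α−2) (p − 8y²). -/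
open Complex

lemma aux_unique (p : ℕ) (hp : p.Prime) (x y a c : ℤ) (h1 : (p : ℤ) = x ^ 2 + 4 * y ^ 2)
    (h2 : (p : ℤ) = a ^ 2 + 4 * c ^ 2) : y ^ 2 = c ^ 2 := by
  have hp0 : (0 : ℤ) < p := by exact_mod_cast hp.pos
  have key : ∀ c : ℤ, (p : ℤ) = a ^ 2 + 4 * c ^ 2 → (p : ℤ) ∣ a * y - c * x → y ^ 2 = c ^ 2 := by
    intro c h2 ⟨k, hk⟩
    have e : (p : ℤ) ^ 2 = (a * x + 4 * c * y) ^ 2 + 4 * (p * k) ^ 2 := by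
      rw [← hk]
      calc (p : ℤ) ^ 2 = (x ^ 2 + 4 * y ^ 2) * (a ^ 2 + 4 * c ^ 2) := by rw [← h1, ← h2]; ring
        _ = _ := by ring
    have hk0 : k = 0 := by
      by_contra hne
      have : 1 ≤ k ^ 2 := by have := sq_pos_of_ne_zero hne; omega
      nlinarith [sq_nonneg (a * x + 4 * c * y), sq_pos_of_pos hp0]
    rw [hk0, mul_zero] at hk
    have : (p : ℤ) * (y ^ 2 - c ^ 2) = 0 := by
      have : (p : ℤ) * (y ^ 2 - c ^ 2) = (a * y - c * x) * (a * y + c * x) := by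
        linear_combination y ^ 2 * h2 - c ^ 2 * h1
      rw [this, hk, zero_mul]
    rcases mul_eq_zero.mp this with h | h
    · omega
    · linarith
  have hd : (p : ℤ) ∣ (a * y - c * x) * (a * y + c * x) :=
    ⟨y ^ 2 - c ^ 2, by linear_combination c ^ 2 * h1 - y ^ 2 * h2⟩
  rcases (Nat.prime_iff_prime_int.mp hp).dvd_or_dvd hd with h | h
  · exact key c h2 h
  · have := key (-c) (by rw [h2]; ring) (by simpa using h)
    simpa using this

lemma aux_adjoin (z : ℂ) (hz : z ∈ Algebra.adjoin ℤ {I}) : ∃ m n : ℤ, z = m + n * I := by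
  induction hz using Algebra.adjoin_induction with
  | mem x hx => exact ⟨0, 1, by simp_all⟩
  | algebraMap r => exact ⟨r, 0, by simp⟩
  | add x y _ _ hx hy =>
    obtain ⟨a, b, rfl⟩ := hx
    obtain ⟨c, d, rfl⟩ := hy
    exact ⟨a + c, b + d, by push_cast; ring⟩
  | mul x y _ _ hx hy =>
    obtain ⟨a, b, rfl⟩ := hx
    obtain ⟨c, d, rfl⟩ := hy
    exact ⟨a * c - b * d, a * d + b * c, by push_cast; linear_combination (b * d : ℂ) * I_sq⟩

lemma aux_prime (p : ℕ) [Fact p.Prime] (x y : ℤ) (hp4 : p % 4 = 1)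
    (hxy : (p : ℤ) = x ^ 2 + 4 * y ^ 2)
    (ψ φ : DirichletCharacter ℂ p) (hψ : orderOf ψ = 4) (hφ : orderOf φ = 2) :
    (jacobiSum ψ φ) ^ 2 + ((starRingEnd ℂ) (jacobiSum ψ φ)) ^ 2 = 2 * ((p : ℂ) - 8 * (y : ℂ) ^ 2) := by
  have hp : p.Prime := Fact.out
  have hψ4 : ψ ^ 4 = 1 := hψ ▸ pow_orderOf_eq_one ψ
  have hφ2 : φ ^ 2 = 1 := hφ ▸ pow_orderOf_eq_one φ
  have hφ4 : φ ^ 4 = 1 := by rw [show 4 = 2 * 2 from rfl, pow_mul, hφ2, one_pow]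
  have hψ1 : ψ ≠ 1 := by rintro rfl; simp at hψ
  have hφ1 : φ ≠ 1 := by rintro rfl; simp at hφ
  have hψφ : ψ * φ ≠ 1 := by
    intro h
    have : ψ ^ 2 = 1 := by
      have h' : (ψ * φ) ^ 2 = 1 := by rw [h, one_pow]
      rwa [mul_pow, hφ2, mul_one] at h'
    have := orderOf_dvd_of_pow_eq_one this
    rw [hψ] at this
    omega
  obtain ⟨z, hz, hJ⟩ := exists_jacobiSum_eq_neg_one_add (F := ZMod p) (by norm_num : 2 < 4) hψ4 hφ4
    (by rw [ZMod.card]; omega) Complex.isPrimitiveRoot_I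
  obtain ⟨m, n, rfl⟩ := aux_adjoin z hz
  have hJ' : jacobiSum ψ φ = (2 * n - 1 : ℤ) + 2 * (-m : ℤ) * I := by
    rw [hJ]; push_cast
    linear_combination (m + n * I - 2 * n : ℂ) * I_sq
  have hc : (starRingEnd ℂ) (jacobiSum ψ φ) = jacobiSum ψ⁻¹ φ⁻¹ := by
    simp only [jacobiSum, map_sum, map_mul, ← MulChar.star_apply']
    rfl
  have hmul := jacobiSum_mul_jacobiSum_inv (F := ZMod p) (F' := ℂ)
    (by rw [ringChar.eq_zero, ZMod.ringChar_zmod_n]; exact hp.ne_zero.symm) hψ1 hφ1 hψφ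
  rw [← hc, ZMod.card] at hmul
  have hcc : (starRingEnd ℂ) (jacobiSum ψ φ) = (2 * n - 1 : ℤ) - 2 * (-m : ℤ) * I := by
    have h2 : (starRingEnd ℂ) 2 = 2 := Complex.conj_ofNat 2
    rw [hJ']; simp [h2]
  rw [hcc, hJ'] at hmul
  rw [hcc, hJ']
  have e : (p : ℤ) = (2 * n - 1) ^ 2 + 4 * (-m) ^ 2 := by
    have : (p : ℂ) = ((2 * n - 1 : ℤ) : ℂ) ^ 2 + 4 * ((-m : ℤ) : ℂ) ^ 2 := by
      rw [← hmul]; linear_combination (-4 * ((-m : ℤ) : ℂ) ^ 2) * I_sq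
    exact_mod_cast this
  have hy := aux_unique p hp x y _ _ hxy e
  have hy' : (y : ℂ) ^ 2 = ((-m : ℤ) : ℂ) ^ 2 := by exact_mod_cast hy
  have e' : (p : ℂ) = ((2 * n - 1 : ℤ) : ℂ) ^ 2 + 4 * ((-m : ℤ) : ℂ) ^ 2 := by exact_mod_cast e
  rw [hy', e']
  linear_combination (8 * ((-m : ℤ) : ℂ) ^ 2) * I_sq

lemma aux_factors (p α : ℕ) [Fact p.Prime] (hp4 : p % 4 = 1) (hα : 1 ≤ α)
    (χ : DirichletCharacter ℂ (p ^ α)) (hχ : χ ^ 4 = 1) :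
    ∃ χ' : DirichletCharacter ℂ p,
      χ = DirichletCharacter.changeLevel (dvd_pow_self p (by omega)) χ' := by
  have hp : p.Prime := Fact.out
  have hd : p ∣ p ^ α := dvd_pow_self p (by omega)
  have : NeZero (p ^ α) := ⟨pow_ne_zero _ hp.ne_zero⟩
  suffices h : χ.FactorsThrough p by
    obtain ⟨_, χ', h⟩ := h
    exact ⟨χ', h⟩
  rw [DirichletCharacter.factorsThrough_iff_ker_unitsMap hd]
  intro u hu
  have hu1 : ((u : ZMod (p ^ α)).cast : ZMod p) = 1 := by
    have := congrArg Units.val (MonoidHom.mem_ker.mp hu)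
    simpa [ZMod.unitsMap_val] using this
  have hdv : (p : ZMod (p ^ α)) ∣ (u : ZMod (p ^ α)) - 1 := by
    obtain ⟨k, hk⟩ := ZMod.intCast_surjective (u : ZMod (p ^ α))
    rw [← hk] at hu1 ⊢
    rw [ZMod.cast_intCast hd] at hu1
    have : (p : ℤ) ∣ k - 1 := by
      rw [← ZMod.intCast_zmod_eq_zero_iff_dvd]
      simp [hu1]
    obtain ⟨t, ht⟩ := this
    exact ⟨t, by exact_mod_cast congrArg (Int.cast : ℤ → ZMod (p ^ α)) ht⟩
  have hup : u ^ (p ^ (α - 1)) = 1 := by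
    have h := dvd_sub_pow_of_dvd_sub hdv (α - 1)
    rw [show α - 1 + 1 = α by omega, ← Nat.cast_pow, ZMod.natCast_self, zero_dvd_iff, one_pow,
      sub_eq_zero] at h
    ext
    simpa using h
  rw [MonoidHom.mem_ker]
  have h1 : χ.toUnitHom u ^ (p ^ (α - 1)) = 1 := by rw [← map_pow, hup, map_one]
  have h2 : χ.toUnitHom u ^ 4 = 1 := by
    ext
    have : (χ ^ 4) u = 1 := by rw [hχ]; simp
    rw [MulChar.pow_apply_coe] at this
    simpa using this
  have hcop : Nat.Coprime (p ^ (α - 1)) 4 := by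
    apply Nat.Coprime.pow_left
    rw [Nat.coprime_iff_gcd_eq_one, Nat.gcd_comm, Nat.gcd_rec, hp4]; simp
  have := Nat.dvd_gcd (orderOf_dvd_of_pow_eq_one h1) (orderOf_dvd_of_pow_eq_one h2)
  rw [hcop] at this
  exact orderOf_eq_one_iff.mp (Nat.dvd_one.mp this)

lemma aux_apply (p α : ℕ) [Fact p.Prime] (hα : α ≠ 0) (χ : DirichletCharacter ℂ p)
    (a : ZMod (p ^ α)) :
    DirichletCharacter.changeLevel (dvd_pow_self p hα) χ a
      = χ (ZMod.castHom (dvd_pow_self p hα) (ZMod p) a) := by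
  by_cases ha : IsUnit a
  · obtain ⟨u, rfl⟩ := ha
    rw [DirichletCharacter.changeLevel_eq_cast_of_dvd]
    rfl
  · rw [MulChar.map_nonunit _ ha, MulChar.map_nonunit]
    contrapose! ha
    obtain ⟨k, rfl⟩ := (show ∃ k : ℕ, (k : ZMod (p ^ α)) = a from
      have : NeZero (p ^ α) := ⟨pow_ne_zero _ (Fact.out : p.Prime).ne_zero⟩
      ⟨a.val, ZMod.natCast_zmod_val a⟩)
    rw [map_natCast, ZMod.isUnit_iff_coprime] at ha
    rw [ZMod.isUnit_iff_coprime]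
    exact ha.pow_right _

lemma aux_sum (p α : ℕ) [Fact p.Prime] [NeZero (p ^ α)] (hα : 1 ≤ α) (f : ZMod p → ℂ)
    (hd : p ∣ p ^ α) :
    ∑ a : ZMod (p ^ α), f (ZMod.castHom hd (ZMod p) a) = (p : ℂ) ^ (α - 1) * ∑ b, f b := by
  classical
  have hp : p.Prime := Fact.out
  set g := ZMod.castHom hd (ZMod p)
  have hs : Function.Surjective g := ZMod.castHom_surjective hd
  have hcf : ∀ b, (Finset.univ.filter (fun a => g a = b)).card
      = (Finset.univ.filter (fun a => g a = 0)).card := fun b =>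
    AddMonoidHom.card_fiber_eq_of_mem_range g (hs b) (hs 0)
  have hcard : (Finset.univ.filter (fun a => g a = 0)).card = p ^ (α - 1) := by
    have h := Finset.card_eq_sum_card_fiberwise (f := g) (s := Finset.univ) (t := Finset.univ)
      (by simp)
    simp only [hcf, Finset.sum_const, Finset.card_univ, ZMod.card, smul_eq_mul] at h
    have h2 : p ^ α = p * p ^ (α - 1) := by rw [← pow_succ']; congr 1; omega
    exact (Nat.eq_of_mul_eq_mul_left hp.pos (h2.symm.trans h)).symm
  rw [← Finset.sum_fiberwise (s := Finset.univ) (g := g), Finset.mul_sum]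
  refine Finset.sum_congr rfl fun b _ => ?_
  rw [Finset.sum_congr rfl (g := fun _ => f b) (by intro a ha; rw [(Finset.mem_filter.mp ha).2]),
    Finset.sum_const, hcf, hcard]
  simp

/-- Let `p ≡ 1 (mod 4)` be a prime, `α ≥ 1`, and `p = x² + 4y²` with `x, y ∈ ℤ`. Let `ψ` be a
Dirichlet character modulo `p^α` of order `4` and `φ` the Dirichlet character modulo `p^α` of
order `2`, and let `J(ψ,φ) = Σ_a ψ(a)φ(1-a)` be their Jacobi sum (a finite sum over
`ℤ/p^αℤ`). Then `J(ψ,φ)² + conj(J(ψ,φ))² = 2p^(2α-2)(p - 8y²)`. -/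
theorem jacobiSum_sq_add_conj_sq (p α : ℕ) (x y : ℤ)
    (hp : p.Prime) (hp4 : p % 4 = 1) (hα : 1 ≤ α)
    (hxy : (p : ℤ) = x ^ 2 + 4 * y ^ 2)
    (ψ : DirichletCharacter ℂ (p ^ α)) (hψ : orderOf ψ = 4)
    (φ : DirichletCharacter ℂ (p ^ α)) (hφ : orderOf φ = 2) :
    (∑ᶠ a : ZMod (p ^ α), ψ a * φ (1 - a)) ^ 2 +
      ((starRingEnd ℂ) (∑ᶠ a : ZMod (p ^ α), ψ a * φ (1 - a))) ^ 2 =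
      2 * (p : ℂ) ^ (2 * α - 2) * ((p : ℂ) - 8 * (y : ℂ) ^ 2) := by
  have : Fact p.Prime := ⟨hp⟩
  have : NeZero (p ^ α) := ⟨pow_ne_zero _ hp.ne_zero⟩
  have hψ4 : ψ ^ 4 = 1 := hψ ▸ pow_orderOf_eq_one ψ
  have hφ2 : φ ^ 2 = 1 := hφ ▸ pow_orderOf_eq_one φ
  have hφ4 : φ ^ 4 = 1 := by rw [show 4 = 2 * 2 from rfl, pow_mul, hφ2, one_pow]
  have hα0 : α ≠ 0 := by omega
  have hd : p ∣ p ^ α := dvd_pow_self p hα0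
  obtain ⟨ψ', rfl⟩ := aux_factors p α hp4 hα ψ hψ4
  obtain ⟨φ', rfl⟩ := aux_factors p α hp4 hα φ hφ4
  rw [orderOf_injective _ (DirichletCharacter.changeLevel_injective hd)] at hψ hφ
  have hS : (∑ᶠ a : ZMod (p ^ α), DirichletCharacter.changeLevel hd ψ' a *
      DirichletCharacter.changeLevel hd φ' (1 - a)) = (p : ℂ) ^ (α - 1) * jacobiSum ψ' φ' := by
    rw [finsum_eq_sum_of_fintype, jacobiSum,
      ← aux_sum p α hα (fun b => ψ' b * φ' (1 - b)) hd]
    refine Finset.sum_congr rfl fun a _ => ?_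
    rw [aux_apply p α hα0, aux_apply p α hα0, map_sub, map_one]
  rw [hS]
  have h := aux_prime p x y hp4 hxy ψ' φ' hψ hφ
  rw [map_mul, map_pow, Complex.conj_natCast, show 2 * α - 2 = (α - 1) * 2 by omega, pow_mul]
  linear_combination ((p : ℂ) ^ (α - 1)) ^ 2 * h
end
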